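/- For every integer N ≥ 2, any feasible point (f1, g1, l1, m1, c_fl, c_mg, c_ba, t) of the identity-bridge lower-bound problem with m1 > 2 has objective value G > 3N − 1; consequently, no global minimizer of the identity-bridge lower-bound problem has m1 > 2. -/

import Mathlib

/-- The objective `G` of the lower-bound problems:
`G = √((c_fl² + c_mg² + N·c_ba²)/2) + (N−1)·√((f1−m1)² + (g1−l1)² + 4t)`. -/
noncomputable def Gobj (N : ℕ) (f1 g1 l1 m1 cfl cmg cba t : ℝ) : ℝ :=
  Real.sqrt ((cfl ^ 2 + cmg ^ 2 + N * cba ^ 2) / 2) +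
    ((N : ℝ) - 1) * Real.sqrt ((f1 - m1) ^ 2 + (g1 - l1) ^ 2 + 4 * t)

/-- Feasible set of the identity-bridge lower-bound problem. -/
def FeasIdnLB (N : ℕ) (f1 g1 l1 m1 cfl cmg cba t : ℝ) : Prop :=
  1 ≤ f1 ∧ 1 ≤ l1 ∧ 1 ≤ m1 ∧
  ((N : ℝ) - 1) * f1 + cfl + N * cba + N ≤ ((N : ℝ) - 1) * l1 ∧
  ((N : ℝ) - 1) * l1 + N ≤ ((N : ℝ) - 1) * f1 + cfl ∧
  ((N : ℝ) - 1) * g1 + N ≤ ((N : ℝ) - 1) * m1 + cmg ∧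
  -g1 + N ≤ ((N : ℝ) - 1) * m1 + cmg ∧
  f1 * m1 ≤ t ∧
  g1 * l1 ≤ t

/-- The two constraints coupling `f1`, `l1` and `c_fl` force `c_ba ≤ -2`. -/
theorem FeasIdnLB.cba_le {N : ℕ} (hN : 0 < N) {f1 g1 l1 m1 cfl cmg cba t : ℝ}
    (h : FeasIdnLB N f1 g1 l1 m1 cfl cmg cba t) : cba ≤ -2 := by
  obtain ⟨-, -, -, h1, h2, -⟩ := h
  have hN' : (0 : ℝ) < N := by exact_mod_cast hN
  refine le_of_mul_le_mul_left ?_ hN'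
  linarith

/-- At a feasible point the second square root of the objective is at least `f1 + m1`, and the
first one is at least `2`. -/
theorem FeasIdnLB.le_Gobj {N : ℕ} (hN : 2 ≤ N) {f1 g1 l1 m1 cfl cmg cba t : ℝ}
    (h : FeasIdnLB N f1 g1 l1 m1 cfl cmg cba t) :
    2 + ((N : ℝ) - 1) * (f1 + m1) ≤ Gobj N f1 g1 l1 m1 cfl cmg cba t := by
  have hN' : (2 : ℝ) ≤ N := by exact_mod_cast hN
  have hba : 4 ≤ cba ^ 2 := by nlinarith [h.cba_le (by lia)]
  obtain ⟨-, -, -, -, -, -, -, ht, -⟩ := h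
  unfold Gobj
  gcongr
  · apply Real.le_sqrt_of_sq_le
    nlinarith [sq_nonneg cfl, sq_nonneg cmg]
  · linarith
  · apply Real.le_sqrt_of_sq_le
    nlinarith [sq_nonneg (g1 - l1)]

/-- The feasible point with `f1 = g1 = l1 = m1 = t = 1`, `c_fl = c_mg = N` and `c_ba = -2`. -/
theorem feasIdnLB_ones (N : ℕ) : FeasIdnLB N 1 1 1 1 N N (-2) 1 := by
  refine ⟨?_, ?_, ?_, ?_, ?_, ?_, ?_, ?_, ?_⟩ <;>
    linarith [(N.cast_nonneg : (0 : ℝ) ≤ N)]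

theorem Gobj_ones_le (N : ℕ) : Gobj N 1 1 1 1 N N (-2) 1 ≤ 3 * (N : ℝ) - 1 := by
  have h1 : √(((N : ℝ) ^ 2 + (N : ℝ) ^ 2 + N * (-2) ^ 2) / 2) ≤ N + 1 := by
    rw [Real.sqrt_le_left (by positivity)]
    linarith
  have h2 : √(((1 : ℝ) - 1) ^ 2 + (1 - 1) ^ 2 + 4 * 1) = 2 := by
    rw [Real.sqrt_eq_iff_mul_self_eq] <;> norm_num
  unfold Gobj
  rw [h2]
  linarith

/-- Any feasible point of the identity-bridge lower-bound
problem with `m1 > 2` has objective value `G > 3N − 1`; consequently, no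
global minimizer of the identity-bridge lower-bound problem has `m1 > 2`. -/
theorem identity_bridge_m1_le_two (N : ℕ) (hN : 2 ≤ N) :
    (∀ f1 g1 l1 m1 cfl cmg cba t : ℝ,
      FeasIdnLB N f1 g1 l1 m1 cfl cmg cba t → 2 < m1 →
      3 * (N : ℝ) - 1 < Gobj N f1 g1 l1 m1 cfl cmg cba t) ∧
    (∀ f1 g1 l1 m1 cfl cmg cba t : ℝ,
      FeasIdnLB N f1 g1 l1 m1 cfl cmg cba t →
      (∀ f1' g1' l1' m1' cfl' cmg' cba' t' : ℝ,
        FeasIdnLB N f1' g1' l1' m1' cfl' cmg' cba' t' →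
        Gobj N f1 g1 l1 m1 cfl cmg cba t ≤ Gobj N f1' g1' l1' m1' cfl' cmg' cba' t') →
      ¬ (2 < m1)) := by
  have key : ∀ f1 g1 l1 m1 cfl cmg cba t : ℝ,
      FeasIdnLB N f1 g1 l1 m1 cfl cmg cba t → 2 < m1 →
      3 * (N : ℝ) - 1 < Gobj N f1 g1 l1 m1 cfl cmg cba t := by
    intro f1 g1 l1 m1 cfl cmg cba t h hm
    have hN' : (2 : ℝ) ≤ N := by exact_mod_cast hN
    have hf : 1 ≤ f1 := h.1
    have hG := h.le_Gobj hN
    nlinarith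
  refine ⟨key, fun f1 g1 l1 m1 cfl cmg cba t h hmin hm => ?_⟩
  exact (key _ _ _ _ _ _ _ _ h hm).not_ge
    ((hmin _ _ _ _ _ _ _ _ (feasIdnLB_ones N)).trans (Gobj_ones_le N))
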